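/- Let F : ℝ → ℝ be arbitrary and let K_φ : ℝ × ℝ → ℝ be symmetric (K_φ(s,t) = K_φ(t,s) for all s,t). Define K(x,y) = F(d(x,y)) · K_φ(φ_x, φ_y) on the unit sphere, where d(x,y) = arccos⟨x,y⟩ and φ_x = arcsin(x₃). Then for all θ₁, θ₂ ∈ ℝ and φ₁, φ₂ ∈ [−π/2, π/2], K(P(θ₁, φ₁), P(θ₂, φ₂)) = K(P(θ₁, φ₂), P(θ₂, φ₁)); i.e. K is latitudinally reversible. -/

import Mathlib

open Real
open scoped RealInnerProductSpace

/-- The spherical parametrization P(θ,φ) = (cos φ cos θ, cos φ sin θ, sin φ). -/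
noncomputable def sphParam (θ φ : ℝ) : EuclideanSpace ℝ (Fin 3) :=
  (WithLp.equiv 2 (Fin 3 → ℝ)).symm ![cos φ * cos θ, cos φ * sin θ, sin φ]

/-- The kernel K(x,y) = F(d(x,y)) · K_φ(φ_x, φ_y) with symmetric K_φ is
latitudinally reversible: swapping the two latitudes leaves it unchanged. -/
theorem product_kernel_latitudinally_reversible (F : ℝ → ℝ) (Kφ : ℝ × ℝ → ℝ)
    (hφsym : ∀ s t : ℝ, Kφ (s, t) = Kφ (t, s)) :
    ∀ θ₁ θ₂ : ℝ, ∀ φ₁ ∈ Set.Icc (-(π / 2)) (π / 2), ∀ φ₂ ∈ Set.Icc (-(π / 2)) (π / 2),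
      F (arccos ⟪sphParam θ₁ φ₁, sphParam θ₂ φ₂⟫) *
        Kφ (arcsin (sphParam θ₁ φ₁ 2), arcsin (sphParam θ₂ φ₂ 2)) =
      F (arccos ⟪sphParam θ₁ φ₂, sphParam θ₂ φ₁⟫) *
        Kφ (arcsin (sphParam θ₁ φ₂ 2), arcsin (sphParam θ₂ φ₁ 2)) := by
  intro θ₁ θ₂ φ₁ _ φ₂ _
  have hin : ∀ a b c d : ℝ, ⟪sphParam a b, sphParam c d⟫ =
      cos b * cos a * (cos d * cos c) + cos b * sin a * (cos d * sin c) + sin b * sin d := by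
    intro a b c d
    simp [sphParam, PiLp.inner_apply, Fin.sum_univ_three]
    ring
  have h2 : ∀ a b : ℝ, sphParam a b 2 = sin b := by
    intro a b
    simp [sphParam]
  rw [hin, hin, h2, h2, h2, h2, hφsym]
  congr 3
  ring
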